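/- Matrix Chernoff bound with intrinsic dimension for DPPs: Let X be a determinantal point process on {1,…,m} with Hermitian correlation kernel. Let Y_1,…,Y_m be d×d Hermitian matrices with 0 ⪯ Y_i ⪯ rI for all i and some r > 0, and assume E_X[Σ_{i∈X} Y_i] ⪯ M for some nonzero positive semidefinite Hermitian matrix M. Let intdim(M) = Tr(M)/‖M‖_op and κ = ‖M‖_op. Then for all ε ∈ (0,1], Pr[‖Σ_{i∈X} Y_i − E_X[Σ_{i∈X} Y_i]‖_op ≥ εκ] ≤ 2·intdim(M)·(1 + c₁·r²/(κ²ε⁴))·exp(−c₂·κε²/r), where c₁ = 3·37² and c₂ = 1/(2·37). -/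

import Mathlib

open Matrix Finset
open scoped Classical ComplexOrder

/-- Operator norm of a square complex matrix (largest singular value). -/
noncomputable def opNorm {k : ℕ} (A : Matrix (Fin k) (Fin k) ℂ) : ℝ :=
  ‖Matrix.toEuclideanCLM (𝕜 := ℂ) A‖

/-- Principal submatrix of `A` indexed by the finite set `S`. -/
noncomputable def principalSub {α : Type*} [Fintype α] [DecidableEq α]
    (A : Matrix α α ℂ) (S : Finset α) : Matrix S S ℂ :=
  A.submatrix (fun i => (i : α)) (fun i => (i : α))

/-- `μ` is the law of a determinantal point process with correlation kernel `K`. -/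
def IsDPP {α : Type*} [Fintype α] [DecidableEq α]
    (μ : Finset α → ℝ) (K : Matrix α α ℂ) : Prop :=
  ∀ A : Finset α,
    ((∑ F ∈ Finset.univ.filter (fun F => A ⊆ F), μ F : ℝ) : ℂ) = (principalSub K A).det

section TraceExponential

open Filter Topology
open scoped MatrixOrder Matrix.Norms.L2Operator

theorem norm_normedSpaceExp_le {𝔸 : Type*} [NormedRing 𝔸] [NormedAlgebra ℝ 𝔸] [CompleteSpace 𝔸]
    [NormOneClass 𝔸] (a : 𝔸) : ‖NormedSpace.exp a‖ ≤ Real.exp ‖a‖ := by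
  rw [NormedSpace.exp_eq_tsum ℝ, Real.exp_eq_exp_ℝ, NormedSpace.exp_eq_tsum ℝ]
  refine tsum_of_norm_bounded (NormedSpace.expSeries_summable' (𝕂 := ℝ) ‖a‖).hasSum fun n => ?_
  rw [norm_smul]
  simp only [smul_eq_mul, norm_inv, RCLike.norm_natCast]
  gcongr
  exact norm_pow_le a n

theorem norm_pow_sub_pow_le_mul {𝔸 : Type*} [NormedRing 𝔸] [NormOneClass 𝔸]
    (x y : 𝔸) {c : ℝ} (hc : 1 ≤ c) (hx : ‖x‖ ≤ c) (hy : ‖y‖ ≤ c) (n : ℕ) :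
    ‖x ^ n - y ^ n‖ ≤ n * ‖x - y‖ * c ^ n := by
  induction n with
  | zero => simp
  | succ n ih =>
    have hsplit : x ^ (n + 1) - y ^ (n + 1) = (x ^ n - y ^ n) * x + y ^ n * (x - y) := by
      rw [pow_succ, pow_succ]; noncomm_ring
    have hyn : ‖y ^ n‖ ≤ c ^ n := (norm_pow_le y n).trans (by gcongr)
    have hcn : c ^ n ≤ c ^ (n + 1) := pow_le_pow_right₀ hc (Nat.le_succ n)
    calc ‖x ^ (n + 1) - y ^ (n + 1)‖
        ≤ ‖x ^ n - y ^ n‖ * ‖x‖ + ‖y ^ n‖ * ‖x - y‖ := by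
          rw [hsplit]
          exact (norm_add_le _ _).trans (add_le_add (norm_mul_le _ _) (norm_mul_le _ _))
      _ ≤ (n * ‖x - y‖ * c ^ n) * c + c ^ (n + 1) * ‖x - y‖ := by
          gcongr
          exact hyn.trans hcn
      _ = (n + 1 : ℕ) * ‖x - y‖ * c ^ (n + 1) := by push_cast; ring

/-- The Lie–Trotter product formula. -/
theorem tendsto_exp_mul_exp_pow {𝔸 : Type*} [NormedRing 𝔸] [NormedAlgebra ℝ 𝔸] [CompleteSpace 𝔸]
    [NormOneClass 𝔸] (a b : 𝔸) :
    Tendsto (fun n : ℕ => (NormedSpace.exp ((n : ℝ)⁻¹ • a) * NormedSpace.exp ((n : ℝ)⁻¹ • b)) ^ n)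
      atTop (𝓝 (NormedSpace.exp (a + b))) := by
  set g : ℝ → 𝔸 := fun t => NormedSpace.exp (t • a) * NormedSpace.exp (t • b)
    - NormedSpace.exp (t • (a + b)) with hg
  have hderiv : HasDerivAt g 0 0 := by
    have h1 := ((hasDerivAt_exp_smul_const (𝕂 := ℝ) a 0).mul
      (hasDerivAt_exp_smul_const (𝕂 := ℝ) b 0)).sub (hasDerivAt_exp_smul_const (𝕂 := ℝ) (a + b) 0)
    exact h1.congr_deriv (by simp)
  have hg0 : g 0 = 0 := by simp [hg]
  have hinv : Tendsto (fun n : ℕ => (n : ℝ)⁻¹) atTop (𝓝[≠] 0) := by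
    refine tendsto_nhdsWithin_iff.2 ⟨tendsto_inv_atTop_nhds_zero_nat, ?_⟩
    filter_upwards [eventually_gt_atTop 0] with n hn
    simp [hn.ne']
  have hslope := ((hasDerivAt_iff_tendsto_slope.1 hderiv).comp hinv).norm
  have hlim : Tendsto (fun n : ℕ => n * ‖g ((n : ℝ)⁻¹)‖ * Real.exp (‖a‖ + ‖b‖)) atTop (𝓝 0) := by
    have h2 := hslope.mul_const (Real.exp (‖a‖ + ‖b‖))
    simp only [norm_zero, zero_mul] at h2
    refine h2.congr fun n => ?_
    simp [slope, hg0, norm_smul]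
  rw [tendsto_iff_norm_sub_tendsto_zero]
  refine squeeze_zero' (.of_forall fun _ => norm_nonneg _) ?_ hlim
  filter_upwards [eventually_gt_atTop 0] with n hn
  have hn' : (n : ℝ) ≠ 0 := by positivity
  have hpow : NormedSpace.exp (a + b) = NormedSpace.exp ((n : ℝ)⁻¹ • (a + b)) ^ n := by
    let _ : NormedAlgebra ℚ 𝔸 := NormedAlgebra.restrictScalars ℚ ℝ 𝔸
    rw [← NormedSpace.exp_nsmul, ← Nat.cast_smul_eq_nsmul ℝ, smul_smul, mul_inv_cancel₀ hn',
      one_smul]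
  set c : ℝ := Real.exp ((n : ℝ)⁻¹ * (‖a‖ + ‖b‖)) with hc
  have hcn : c ^ n = Real.exp (‖a‖ + ‖b‖) := by
    rw [hc, ← Real.exp_nat_mul, ← mul_assoc, mul_inv_cancel₀ hn', one_mul]
  have hsm : ∀ x : 𝔸, ‖(n : ℝ)⁻¹ • x‖ = (n : ℝ)⁻¹ * ‖x‖ := fun x => by
    rw [norm_smul, norm_inv, RCLike.norm_natCast]
  rw [hpow, ← hcn]
  refine norm_pow_sub_pow_le_mul _ _ (Real.one_le_exp (by positivity)) ?_ ?_ n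
  · refine (norm_mul_le _ _).trans ?_
    rw [mul_add, Real.exp_add, ← hsm, ← hsm]
    gcongr <;> exact norm_normedSpaceExp_le _
  · refine (norm_normedSpaceExp_le _).trans ?_
    rw [hsm]
    gcongr
    exact norm_add_le _ _

variable {ι : Type*} [Fintype ι] [DecidableEq ι]

theorem trace_mul_pow_comm (A B : Matrix ι ι ℂ) (n : ℕ) :
    ((A * B) ^ n).trace = ((B * A) ^ n).trace := by
  cases n with
  | zero => simp
  | succ n =>
    have h : (A * B) ^ n * A = A * (B * A) ^ n := by
      induction n with
      | zero => simp
      | succ n ih => rw [pow_succ', pow_succ', mul_assoc, ih]; simp only [mul_assoc]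
    rw [pow_succ, ← mul_assoc, h, trace_mul_comm, ← mul_assoc, ← pow_succ']

theorem norm_trace_mul_le {ι : Type*} [Fintype ι] (A B : Matrix ι ι ℂ) :
    ‖(A * B).trace‖ ≤ ((A * Aᴴ).trace.re + (B * Bᴴ).trace.re) / 2 := by
  have hsq : ∀ C : Matrix ι ι ℂ, (C * Cᴴ).trace.re = ∑ i, ∑ j, ‖C i j‖ ^ 2 := fun C => by
    simp only [trace, diag_apply, mul_apply, conjTranspose_apply, Complex.re_sum]
    refine sum_congr rfl fun i _ => sum_congr rfl fun j _ => ?_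
    rw [Complex.star_def, Complex.mul_conj, Complex.ofReal_re, Complex.normSq_eq_norm_sq]
  rw [hsq A, hsq B, sum_comm (f := fun i j => ‖B i j‖ ^ 2), ← sum_add_distrib, sum_div]
  simp only [trace, diag_apply, mul_apply]
  refine (norm_sum_le _ _).trans (sum_le_sum fun i _ => (norm_sum_le _ _).trans ?_)
  rw [← sum_add_distrib, sum_div]
  refine sum_le_sum fun j _ => ?_
  rw [norm_mul]
  nlinarith [sq_nonneg (‖A i j‖ - ‖B j i‖)]

theorem norm_trace_pow_and_trace_mul_pow_le (k : ℕ) :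
    (∀ X : Matrix ι ι ℂ, ‖(X ^ 2 ^ (k + 1)).trace‖ ≤ ((X * Xᴴ) ^ 2 ^ k).trace.re) ∧
    (∀ P Q : Matrix ι ι ℂ, P.IsHermitian → Q.IsHermitian →
      ‖((P * Q) ^ 2 ^ k).trace‖ ≤ ‖(P ^ 2 ^ k * Q ^ 2 ^ k).trace‖) := by
  induction k with
  | zero =>
    refine ⟨fun X => ?_, fun P Q _ _ => by simp⟩
    have h := norm_trace_mul_le X X
    simp only [zero_add, pow_one, pow_zero, sq]
    linarith
  | succ k ih =>
    obtain ⟨ihX, ihPQ⟩ := ih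
    constructor
    · intro X
      have hP : (X * Xᴴ).IsHermitian := isHermitian_mul_conjTranspose_self X
      have hQ : (Xᴴ * X).IsHermitian := isHermitian_conjTranspose_mul_self X
      have h1 := ihX (X ^ 2)
      have h2 := ihPQ _ _ hP hQ
      have h3 := norm_trace_mul_le ((X * Xᴴ) ^ 2 ^ k) ((Xᴴ * X) ^ 2 ^ k)
      rw [(hP.pow _).eq, (hQ.pow _).eq, ← pow_add, ← pow_add, ← two_mul, ← pow_succ',
        trace_mul_pow_comm Xᴴ X] at h3
      have h4 : ((X ^ 2 * (X ^ 2)ᴴ) ^ 2 ^ k).trace = ((X * Xᴴ * (Xᴴ * X)) ^ 2 ^ k).trace := by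
        rw [sq, conjTranspose_mul, mul_assoc, trace_mul_pow_comm]
        simp only [mul_assoc]
      rw [← pow_mul, ← pow_succ', h4] at h1
      have h5 := Complex.re_le_norm ((X * Xᴴ * (Xᴴ * X)) ^ 2 ^ k).trace
      linarith
    · intro P Q hP hQ
      have h1 := ihX (P * Q)
      have h2 := ihPQ _ _ (hP.pow 2) (hQ.pow 2)
      have h4 : ((P * Q * (P * Q)ᴴ) ^ 2 ^ k).trace = ((P ^ 2 * Q ^ 2) ^ 2 ^ k).trace := by
        rw [conjTranspose_mul, hP.eq, hQ.eq, mul_assoc, trace_mul_pow_comm, sq, sq,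
          trace_mul_pow_comm (P * P)]
        simp only [mul_assoc]
      rw [h4] at h1
      rw [← pow_mul, ← pow_mul, ← pow_succ'] at h2
      exact h1.trans ((Complex.re_le_norm _).trans h2)

theorem trace_mul_posSemidef_nonneg {A B : Matrix ι ι ℂ} (hA : A.PosSemidef) (hB : B.PosSemidef) :
    0 ≤ (A * B).trace := by
  obtain ⟨C, rfl⟩ := CStarAlgebra.nonneg_iff_eq_star_mul_self.1 (nonneg_iff_posSemidef.2 hA)
  rw [mul_assoc, trace_mul_comm]
  exact (hB.mul_mul_conjTranspose_same C).trace_nonneg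

theorem posSemidef_exp {A : Matrix ι ι ℂ} (hA : A.IsHermitian) :
    (NormedSpace.exp A).PosSemidef := by
  rw [← nonneg_iff_posSemidef, ← CFC.real_exp_eq_normedSpace_exp (a := A) hA]
  exact cfc_nonneg fun x _ => (Real.exp_pos x).le

/-- The Golden–Thompson inequality. -/
theorem trace_exp_add_le {A B : Matrix ι ι ℂ} (hA : A.IsHermitian) (hB : B.IsHermitian) :
    (NormedSpace.exp (A + B)).trace.re ≤ (NormedSpace.exp A * NormedSpace.exp B).trace.re := by
  cases isEmpty_or_nonempty ι
  · simp [trace]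
  have hnn := trace_mul_posSemidef_nonneg (posSemidef_exp hA) (posSemidef_exp hB)
  rw [Complex.re_eq_norm.2 hnn]
  refine (Complex.re_le_norm _).trans ?_
  have hpow : Tendsto (fun k : ℕ => 2 ^ k) atTop atTop :=
    tendsto_pow_atTop_atTop_of_one_lt one_lt_two
  have hlim := ((continuous_id.matrix_trace.norm.tendsto _).comp
    ((tendsto_exp_mul_exp_pow A B).comp hpow))
  refine le_of_tendsto hlim (.of_forall fun k => ?_)
  have hherm : ∀ (C : Matrix ι ι ℂ) (t : ℝ), C.IsHermitian →
    (NormedSpace.exp (t • C)).IsHermitian :=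
    fun C t hC => (IsSelfAdjoint.smul (.all t) hC : IsSelfAdjoint (t • C)).isHermitian.exp
  refine ((norm_trace_pow_and_trace_mul_pow_le k).2 _ _ (hherm A _ hA) (hherm B _ hB)).trans_eq ?_
  have hexp : ∀ C : Matrix ι ι ℂ,
      NormedSpace.exp (((2 ^ k : ℕ) : ℝ)⁻¹ • C) ^ 2 ^ k = NormedSpace.exp C := fun C => by
    rw [← Matrix.exp_nsmul, ← Nat.cast_smul_eq_nsmul ℝ, smul_smul, mul_inv_cancel₀ (by positivity),
      one_smul]
  rw [hexp, hexp]

end TraceExponential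

section OperatorInequalities

open scoped MatrixOrder Matrix.Norms.L2Operator

variable {ι : Type*} [Fintype ι] [DecidableEq ι]

theorem isHermitian_realSmul {ι : Type*} {A : Matrix ι ι ℂ} (hA : A.IsHermitian) (t : ℝ) :
    (t • A).IsHermitian :=
  (IsSelfAdjoint.smul (.all t) hA : IsSelfAdjoint (t • A))

theorem exp_le_one_add_add_sq {A : Matrix ι ι ℂ} (hA : A.IsHermitian)
    (h1 : -1 ≤ A) (h2 : A ≤ 1) : NormedSpace.exp A ≤ 1 + A + A * A := by
  have hsa : IsSelfAdjoint A := hA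
  have hquad : cfc (fun x : ℝ => 1 + x + x * x) A = 1 + A + A * A := by
    rw [cfc_add .., cfc_add .., cfc_mul .., cfc_const_one .., cfc_id' ..]
  rw [← hquad, ← CFC.real_exp_eq_normedSpace_exp (a := A) hsa]
  refine cfc_mono fun x hx => ?_
  have hx1 : -1 ≤ x := (algebraMap_le_iff_le_spectrum (a := A) (r := (-1 : ℝ))).1
    (by simpa using h1) x hx
  have hx2 : x ≤ 1 := (le_algebraMap_iff_spectrum_le (a := A) (r := (1 : ℝ))).1
    (by simpa using h2) x hx
  have h := (abs_le.1 (Real.abs_exp_sub_one_sub_id_le (abs_le.2 ⟨hx1, hx2⟩))).2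
  nlinarith

theorem exp_le_one_add_smul {A : Matrix ι ι ℂ} (h1 : 0 ≤ A) {c : ℝ} (hc : 0 < c)
    (h2 : A ≤ algebraMap ℝ _ c) :
    NormedSpace.exp A ≤ 1 + ((Real.exp c - 1) / c) • A := by
  have hsa : IsSelfAdjoint A := .of_nonneg h1
  have hlin : cfc (fun x : ℝ => 1 + ((Real.exp c - 1) / c) * x) A
      = 1 + ((Real.exp c - 1) / c) • A := by
    rw [cfc_add .., cfc_const_mul .., cfc_const_one .., cfc_id' ..]
  rw [← hlin, ← CFC.real_exp_eq_normedSpace_exp (a := A) hsa]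
  refine cfc_mono fun x hx => ?_
  have hx1 : 0 ≤ x := spectrum_nonneg_of_nonneg h1 hx
  have hx2 : x ≤ c := (le_algebraMap_iff_spectrum_le (a := A)).1 h2 x hx
  have h := convexOn_exp.2 (Set.mem_univ 0) (Set.mem_univ c)
    (sub_nonneg.2 ((div_le_one hc).2 hx2)) (div_nonneg hx1 hc.le) (by ring)
  simp only [smul_eq_mul, mul_zero, zero_add, Real.exp_zero, mul_one] at h
  rw [div_mul_cancel₀ _ hc.ne'] at h
  calc Real.exp x ≤ 1 - x / c + x / c * Real.exp c := h
    _ = 1 + (Real.exp c - 1) / c * x := by ring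

theorem mul_self_le_smul {A : Matrix ι ι ℂ} {r : ℝ} (hr : 0 < r) (h0 : 0 ≤ A)
    (h1 : A ≤ r • 1) : A * A ≤ r • A := by
  have hA : A.PosSemidef := nonneg_iff_posSemidef.1 h0
  have hB : (r • 1 - A).PosSemidef := h1
  have key : r • (r • A - A * A) = Aᴴ * (r • 1 - A) * A + (r • 1 - A)ᴴ * A * (r • 1 - A) := by
    rw [hA.isHermitian.eq, hB.isHermitian.eq]
    simp only [mul_sub, sub_mul, smul_mul_assoc, mul_smul_comm, one_mul, mul_one, smul_sub]
    abel
  have hpos : 0 ≤ r • (r • A - A * A) := by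
    rw [key]
    exact nonneg_iff_posSemidef.2
      ((hB.conjTranspose_mul_mul_same A).add (hA.conjTranspose_mul_mul_same _))
  have := smul_nonneg (inv_nonneg.2 hr.le) hpos
  rw [smul_smul, inv_mul_cancel₀ hr.ne', one_smul] at this
  exact sub_nonneg.1 this

theorem sub_mul_self_le {A B : Matrix ι ι ℂ} (hA : A.IsHermitian) (hB : B.IsHermitian) :
    (A - B) * (A - B) ≤ (2 : ℝ) • (A * A) + (2 : ℝ) • (B * B) := by
  have h := nonneg_iff_posSemidef.2 (posSemidef_conjTranspose_mul_self (A + B))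
  rw [(hA.add hB).eq] at h
  rw [← sub_nonneg]
  convert! h using 1
  rw [two_smul, two_smul]
  noncomm_ring

theorem trace_re_mono {ι : Type*} [Fintype ι] {A B : Matrix ι ι ℂ} (h : A ≤ B) :
    A.trace.re ≤ B.trace.re := by
  have := (Complex.le_def.1 (le_iff.1 h).trace_nonneg).1
  rw [trace_sub, Complex.sub_re, Complex.zero_re] at this
  linarith

theorem trace_mul_re_mono {H A B : Matrix ι ι ℂ} (hH : H.PosSemidef) (h : A ≤ B) :
    (H * A).trace.re ≤ (H * B).trace.re := by
  have := (Complex.le_def.1 (trace_mul_posSemidef_nonneg hH (le_iff.1 h))).1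
  rw [mul_sub, trace_sub, Complex.sub_re, Complex.zero_re] at this
  linarith

theorem trace_exp_smul_re {A : Matrix ι ι ℂ} (hA : A.IsHermitian) (t : ℝ) :
    (NormedSpace.exp (t • A)).trace.re = ∑ i, Real.exp (t * hA.eigenvalues i) := by
  have hsa : IsSelfAdjoint A := hA
  rw [← CFC.real_exp_eq_normedSpace_exp (a := t • A) (isHermitian_realSmul hA t),
    ← cfc_comp_smul t Real.exp A, hA.cfc_eq, IsHermitian.cfc, Unitary.conjStarAlgAut_apply,
    trace_mul_cycle, Unitary.coe_star_mul_self, one_mul, trace_diagonal, Complex.re_sum]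
  exact sum_congr rfl fun i _ => Complex.ofReal_re _

theorem exp_sub_le_trace_exp_add_trace_exp_neg {A : Matrix ι ι ℂ} (hA : A.IsHermitian) {s t : ℝ}
    (ht : 0 < t) (h : t ≤ ‖A‖) :
    Real.exp (s * t) - s * t - 1 ≤
      (NormedSpace.exp (s • A)).trace.re + (NormedSpace.exp ((-s) • A)).trace.re
        - 2 * Fintype.card ι := by
  cases isEmpty_or_nonempty ι
  · rw [Subsingleton.elim A 0, norm_zero] at h
    exact absurd h (not_le.2 ht)
  obtain ⟨i, hi⟩ : ∃ i, |hA.eigenvalues i| = ‖A‖ := by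
    have hspec := CStarAlgebra.norm_or_neg_norm_mem_spectrum (a := A) hA
    rw [hA.spectrum_real_eq_range_eigenvalues] at hspec
    rcases hspec with ⟨i, hi⟩ | ⟨i, hi⟩
    · exact ⟨i, by rw [hi, abs_norm]⟩
    · exact ⟨i, by rw [hi, abs_neg, abs_norm]⟩
  rw [trace_exp_smul_re hA, trace_exp_smul_re hA]
  have hcosh : ∀ x : ℝ, Real.exp x + Real.exp (-x) = 2 * Real.cosh x := fun x => by
    rw [Real.cosh_eq]; ring
  have hsum : ∑ j, Real.exp (s * hA.eigenvalues j) + ∑ j, Real.exp (-s * hA.eigenvalues j)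
      - 2 * Fintype.card ι = ∑ j, 2 * (Real.cosh (s * hA.eigenvalues j) - 1) := by
    simp only [mul_sub, sum_sub_distrib, ← hcosh, sum_add_distrib, neg_mul]
    simp [mul_comm]
  rw [hsum]
  refine le_trans ?_ (single_le_sum (f := fun j => 2 * (Real.cosh (s * hA.eigenvalues j) - 1))
    (fun j _ => by have := Real.one_le_cosh (s * hA.eigenvalues j); linarith) (mem_univ i))
  have hmono : Real.cosh (s * t) ≤ Real.cosh (s * hA.eigenvalues i) := by
    rw [Real.cosh_le_cosh, abs_mul, abs_mul, hi, abs_of_pos ht]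
    gcongr
  have h1 := hcosh (s * t)
  have h2 := Real.add_one_le_exp (-(s * t))
  show _ ≤ 2 * (Real.cosh (s * hA.eigenvalues i) - 1)
  linarith

end OperatorInequalities

section DeterminantalKernels

variable {α : Type*} [Fintype α] [DecidableEq α]

theorem det_principalSub (K : Matrix α α ℂ) (A : Finset α) :
    (principalSub K A).det = (Matrix.of (A.piecewise K (1 : Matrix α α ℂ))).det := by
  rw [twoBlockTriangular_det _ (· ∈ A)]
  · have h1 : toSquareBlockProp (Matrix.of (A.piecewise K (1 : Matrix α α ℂ))) (· ∈ A)
        = principalSub K A := by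
      ext i j
      simp [toSquareBlockProp, principalSub, Finset.piecewise, i.2]
    have h2 : toSquareBlockProp (Matrix.of (A.piecewise K (1 : Matrix α α ℂ))) (· ∉ A) = 1 := by
      ext i j
      simp [toSquareBlockProp, Finset.piecewise, i.2, one_apply, Subtype.ext_iff]
    rw [h1, h2, det_one, mul_one]
    congr!
  · intro i hi j hj
    have hij : i ≠ j := fun h => hi (h ▸ hj)
    simp [Finset.piecewise, hi, hij]

/-- The correlation kernel of a determinantal point process conditioned to contain `x`,
with `x` removed. -/
noncomputable def condKernel (K : Matrix α α ℂ) (x : α) : Matrix α α ℂ :=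
  K - (K x x)⁻¹ • (K * single x x 1 * K)

theorem condKernel_apply (K : Matrix α α ℂ) (x i j : α) :
    condKernel K x i j = K i j - (K x x)⁻¹ * (K i x * K x j) := by
  have h : (K * single x x (1 : ℂ) * K : Matrix α α ℂ) i j = K i x * K x j := by
    rw [mul_apply, Finset.sum_eq_single x] <;> simp +contextual
  rw [condKernel, Matrix.sub_apply, Matrix.smul_apply, h, smul_eq_mul]

theorem condKernel_self_left (K : Matrix α α ℂ) {x : α} (hx : K x x ≠ 0) (j : α) :
    condKernel K x x j = 0 := by
  rw [condKernel_apply, ← mul_assoc, inv_mul_cancel₀ hx, one_mul, sub_self]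

theorem det_principalSub_insert (K : Matrix α α ℂ) {x : α} (hx : K x x ≠ 0) {A : Finset α}
    (hxA : x ∉ A) :
    (principalSub K (insert x A)).det = K x x * (principalSub (condKernel K x) A).det := by
  set N : Matrix α α ℂ := Matrix.of (A.piecewise (condKernel K x) (1 : Matrix α α ℂ)) with hN
  have hcol : ∀ i, i ≠ x → N i x = 0 := fun i hi => by
    by_cases hiA : i ∈ A
    · simp only [hN, of_apply, Finset.piecewise, hiA, if_true, condKernel_apply]
      field_simp
      ring
    · simp [hN, Finset.piecewise, hiA, hi]
  have hNx : N x = Pi.single x 1 := by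
    ext j
    simp [hN, Finset.piecewise, hxA, one_apply, Pi.single_apply, eq_comm]
  have hrow : (Matrix.of ((insert x A).piecewise K (1 : Matrix α α ℂ))).det
      = (N.updateRow x (K x)).det := by
    refine det_eq_of_forall_row_eq_smul_add_const
      (fun i => if i ∈ A then (K x x)⁻¹ * K i x else 0) x (by simp [hxA]) fun i j => ?_
    rcases eq_or_ne i x with rfl | hi
    · simp [Finset.piecewise, hxA]
    · by_cases hiA : i ∈ A
      · simp only [of_apply, Finset.piecewise, Finset.mem_insert, hiA, or_true, if_true,
          updateRow_ne hi, updateRow_self, hN, condKernel_apply]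
        ring
      · simp [Finset.piecewise, hi, hiA, hN]
  have hsplit : K x = K x x • Pi.single x 1 + (K x - K x x • Pi.single x 1) := by abel
  have hzero : (N.updateRow x (K x - K x x • Pi.single x 1)).det = 0 := by
    refine det_eq_zero_of_column_eq_zero x fun i => ?_
    rcases eq_or_ne i x with rfl | hi
    · simp
    · rw [updateRow_ne hi, hcol i hi]
  have hdet : (N.updateRow x (K x)).det = K x x * N.det := by
    conv_lhs => rw [hsplit]
    rw [det_updateRow_add, hzero, add_zero, det_updateRow_smul, ← hNx, updateRow_eq_self]
  rw [det_principalSub, det_principalSub, hrow, hdet]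

theorem sum_insert_of_notMem (x : α) (g : Finset α → ℝ) :
    ∑ F : Finset α, (if x ∈ F then 0 else g (insert x F)) = ∑ F, if x ∈ F then g F else 0 := by
  have h1 : ∑ F : Finset α, (if x ∈ F then 0 else g (insert x F))
      = ∑ F ∈ univ.filter (fun F : Finset α => x ∉ F), g (insert x F) := by
    rw [sum_filter]
    exact sum_congr rfl fun F _ => by by_cases h : x ∈ F <;> simp [h]
  rw [h1, ← sum_filter]
  refine sum_nbij' (fun F => insert x F) (fun F => F.erase x) ?_ ?_ ?_ ?_ ?_
  · intro F _; simp
  · intro F _; simp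
  · intro F hF; exact erase_insert (by simpa using hF)
  · intro F hF; exact insert_erase (by simpa using hF)
  · intro F _; rfl

/-- The law of a point process with one-point intensity `p` at `x`, conditioned to contain `x`,
with `x` removed. -/
noncomputable def condWeight (μ : Finset α → ℝ) (p : ℝ) (x : α) (F : Finset α) : ℝ :=
  if x ∈ F then 0 else μ (insert x F) / p

theorem sum_condWeight_mul (μ f : Finset α → ℝ) {p : ℝ} (hp : p ≠ 0) (x : α) :
    p * ∑ F, condWeight μ p x F * f (insert x F) = ∑ F, if x ∈ F then μ F * f F else 0 := by
  rw [← sum_insert_of_notMem x (fun F => μ F * f F), mul_sum]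
  refine sum_congr rfl fun F _ => ?_
  unfold condWeight
  split_ifs
  · simp
  · field_simp

theorem IsDPP.sum_eq_one {μ : Finset α → ℝ} {K : Matrix α α ℂ} (h : IsDPP μ K) :
    ∑ F, μ F = 1 := by
  have h0 := h ∅
  rw [det_isEmpty] at h0
  simpa only [empty_subset, filter_true] using Complex.ofReal_eq_one.1 h0

theorem IsDPP.sum_mem {μ : Finset α → ℝ} {K : Matrix α α ℂ} (h : IsDPP μ K) (x : α) :
    ((∑ F, if x ∈ F then μ F else 0 : ℝ) : ℂ) = K x x := by
  have h0 := h {x}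
  rw [det_eq_elem_of_subsingleton _ ⟨x, mem_singleton_self x⟩] at h0
  simp only [singleton_subset_iff, sum_filter] at h0
  exact h0

theorem IsDPP.sum_mem_re {μ : Finset α → ℝ} {K : Matrix α α ℂ} (h : IsDPP μ K) (x : α) :
    (∑ F, if x ∈ F then μ F else 0) = (K x x).re := by
  rw [← h.sum_mem x, Complex.ofReal_re]

theorem IsDPP.diag_eq {μ : Finset α → ℝ} {K : Matrix α α ℂ} (h : IsDPP μ K) (x : α) :
    K x x = ((K x x).re : ℂ) := by
  rw [← h.sum_mem x, Complex.ofReal_re]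

theorem IsDPP.cond {μ : Finset α → ℝ} {K : Matrix α α ℂ} (h : IsDPP μ K) {x : α}
    (hx : (K x x).re ≠ 0) : IsDPP (condWeight μ (K x x).re x) (condKernel K x) := by
  have hx' : K x x ≠ 0 := fun h0 => hx (by rw [h0, Complex.zero_re])
  intro A
  by_cases hxA : x ∈ A
  · have hrow : (principalSub (condKernel K x) A).det = 0 :=
      det_eq_zero_of_row_eq_zero ⟨x, hxA⟩ fun j => condKernel_self_left K hx' j
    rw [hrow, Complex.ofReal_eq_zero]
    refine sum_eq_zero fun F hF => ?_
    simp [condWeight, (mem_filter.1 hF).2 hxA]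
  · have h1 := det_principalSub_insert K hx' hxA
    rw [← h (insert x A)] at h1
    have h2 := sum_condWeight_mul μ (fun F => if insert x A ⊆ F then 1 else 0) hx x
    have h3 : ∑ F ∈ univ.filter (fun F => A ⊆ F), condWeight μ (K x x).re x F
        = ∑ F, condWeight μ (K x x).re x F * (if insert x A ⊆ insert x F then 1 else 0) := by
      rw [sum_filter]
      refine sum_congr rfl fun F _ => ?_
      by_cases hF : A ⊆ F <;> simp [insert_subset_insert_iff hxA, hF]
    have h4 : ∑ F ∈ univ.filter (fun F => insert x A ⊆ F), μ F
        = ∑ F, if x ∈ F then μ F * (if insert x A ⊆ F then 1 else 0) else 0 := by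
      rw [sum_filter]
      refine sum_congr rfl fun F _ => ?_
      by_cases hF : insert x A ⊆ F
      · simp [hF, hF (mem_insert_self x A)]
      · simp [hF]
    rw [← h3, ← h4] at h2
    rw [← h2, Complex.ofReal_mul, ← h.diag_eq x] at h1
    exact mul_left_cancel₀ hx' h1

theorem IsDPP.sum_mul_card {μ : Finset α → ℝ} {K : Matrix α α ℂ} (h : IsDPP μ K) :
    ∑ F, μ F * (#F : ℝ) = K.trace.re := by
  simp only [trace, diag_apply, Complex.re_sum, ← h.sum_mem_re]
  rw [sum_comm]
  refine sum_congr rfl fun F _ => ?_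
  rw [← sum_filter, sum_const, nsmul_eq_mul, filter_mem_eq_inter, univ_inter, mul_comm]

/-- A determinantal point process is determined by its kernel. -/
theorem IsDPP.unique {μ ν : Finset α → ℝ} {K : Matrix α α ℂ} (hμ : IsDPP μ K) (hν : IsDPP ν K) :
    μ = ν := by
  funext A
  induction A using WellFoundedGT.induction with
  | _ A ih =>
    have h : ∑ F ∈ univ.filter (fun F => A ⊆ F), μ F = ∑ F ∈ univ.filter (fun F => A ⊆ F), ν F :=
      Complex.ofReal_injective ((hμ A).trans (hν A).symm)
    have hA : A ∈ univ.filter (fun F => A ⊆ F) := by simp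
    rw [← add_sum_erase _ _ hA, ← add_sum_erase _ _ hA] at h
    have hrest : ∑ F ∈ (univ.filter (fun F => A ⊆ F)).erase A, μ F
        = ∑ F ∈ (univ.filter (fun F => A ⊆ F)).erase A, ν F := by
      refine sum_congr rfl fun F hF => ih F ?_
      obtain ⟨hne, hF⟩ := mem_erase.1 hF
      exact lt_of_le_of_ne (mem_filter.1 hF).2 hne.symm
    linarith

theorem isHermitian_condKernel {K : Matrix α α ℂ} (hK : K.IsHermitian) (x : α) :
    (condKernel K x).IsHermitian := by
  refine IsHermitian.ext fun i j => ?_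
  simp only [condKernel_apply, star_sub, star_mul', star_inv₀, hK.apply]
  ring

theorem condKernel_mul_self {K : Matrix α α ℂ} (hK : K * K = K) {x : α} (hx : K x x ≠ 0) :
    condKernel K x * condKernel K x = condKernel K x := by
  have hE : K * single x x 1 * K * (K * single x x 1 * K) = K x x • (K * single x x 1 * K) := by
    have h1 : single x x (1 : ℂ) * K * single x x 1 = K x x • single x x 1 := by
      rw [single_mul_mul_single]; simp
    calc K * single x x 1 * K * (K * single x x 1 * K)
        = K * (single x x 1 * (K * K) * single x x 1) * K := by simp only [mul_assoc]
      _ = _ := by rw [hK, h1, mul_smul_comm, smul_mul_assoc]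
  have hl : K * (K * single x x 1 * K) = K * single x x 1 * K := by
    rw [← mul_assoc, ← mul_assoc, hK]
  have hr : K * single x x 1 * K * K = K * single x x 1 * K := by
    rw [mul_assoc, hK]
  unfold condKernel
  rw [sub_mul, mul_sub, mul_sub, hK, mul_smul_comm, smul_mul_assoc, smul_mul_assoc,
    mul_smul_comm, hl, hr, hE, smul_smul _ (K x x), inv_mul_cancel₀ hx, one_smul]
  abel

theorem trace_condKernel {K : Matrix α α ℂ} (hK : K * K = K) {x : α} (hx : K x x ≠ 0) :
    (condKernel K x).trace = K.trace - 1 := by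
  rw [condKernel, trace_sub, trace_smul, trace_mul_comm, ← mul_assoc, hK]
  simp [trace_mul_single, hx]

/-- A determinantal point process with a projection kernel has almost surely as many points as
the rank of the kernel. -/
theorem IsDPP.card_eq {μ : Finset α → ℝ} {K : Matrix α α ℂ} (h : IsDPP μ K) (hμ : ∀ F, 0 ≤ μ F)
    (hK : K * K = K) {n : ℕ} (hn : K.trace = n) {F : Finset α} (hF : μ F ≠ 0) : #F = n := by
  have hx : ∀ x, (∑ F, if x ∈ F then μ F * (#F : ℝ) else 0) = n * (K x x).re := fun x => by
    by_cases hx : (K x x).re = 0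
    · have h0 := h.sum_mem_re x
      rw [hx, sum_eq_zero_iff_of_nonneg
        (fun F _ => by split_ifs; exacts [hμ F, le_rfl])] at h0
      rw [hx, mul_zero]
      refine sum_eq_zero fun F hF => ?_
      have := h0 F hF
      split_ifs at this ⊢ with hxF
      · rw [this, zero_mul]
      · rfl
    · have hx' : K x x ≠ 0 := fun h0 => hx (by rw [h0, Complex.zero_re])
      have hc := h.cond hx
      rw [← sum_condWeight_mul μ (fun F => (#F : ℝ)) hx x]
      have hsum : ∑ F, condWeight μ (K x x).re x F * (#(insert x F) : ℝ)
          = ∑ F, condWeight μ (K x x).re x F * (#F : ℝ) + ∑ F, condWeight μ (K x x).re x F := by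
        rw [← sum_add_distrib]
        refine sum_congr rfl fun F _ => ?_
        unfold condWeight
        split_ifs with hxF
        · simp
        · rw [card_insert_of_notMem hxF]; push_cast; ring
      rw [hsum, hc.sum_mul_card, hc.sum_eq_one, trace_condKernel hK hx', hn]
      simp [mul_comm]
  have h1 : ∑ F, μ F * (#F : ℝ) = n := by rw [h.sum_mul_card, hn, Complex.natCast_re]
  have h2 : ∑ F, μ F * (#F : ℝ) * #F = n * n := by
    have h3 : ∑ x, (∑ F, if x ∈ F then μ F * (#F : ℝ) else 0) = n * n := by
      rw [sum_congr rfl fun x _ => hx x, ← mul_sum]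
      congr 1
      rw [← Complex.re_sum, ← Complex.natCast_re n, ← hn]
      rfl
    rw [← h3, sum_comm]
    refine sum_congr rfl fun F _ => ?_
    rw [← sum_filter, sum_const, nsmul_eq_mul, filter_mem_eq_inter, univ_inter, mul_comm]
  have hvar : ∑ F, μ F * ((#F : ℝ) - n) ^ 2 = 0 := by
    have : ∀ F : Finset α, μ F * ((#F : ℝ) - n) ^ 2
        = μ F * (#F : ℝ) * #F - 2 * n * (μ F * (#F : ℝ)) + n ^ 2 * μ F := fun F => by ring
    simp only [this, sum_add_distrib, sum_sub_distrib, ← mul_sum, h1, h2, h.sum_eq_one]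
    ring
  rw [sum_eq_zero_iff_of_nonneg (fun F _ => mul_nonneg (hμ F) (sq_nonneg _))] at hvar
  have := (mul_eq_zero.1 (hvar F (mem_univ F))).resolve_left hF
  exact_mod_cast sub_eq_zero.1 (pow_eq_zero_iff two_ne_zero |>.1 this)

end DeterminantalKernels

section Existence

open Filter Topology
open scoped MatrixOrder Matrix.Norms.L2Operator

variable {α : Type*} [Fintype α] [DecidableEq α]

theorem posSemidef_mul_one_sub {K : Matrix α α ℂ} (hK0 : K.PosSemidef)
    (hK1 : (1 - K).PosSemidef) : (K * (1 - K)).PosSemidef := by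
  have h := (hK1.conjTranspose_mul_mul_same K).add (hK0.conjTranspose_mul_mul_same (1 - K))
  rw [hK0.isHermitian.eq, hK1.isHermitian.eq] at h
  convert! h using 1
  noncomm_ring

/-- The probability that a determinantal point process with kernel `K` equals `F`. -/
noncomputable def dppWeight (K : Matrix α α ℂ) (F : Finset α) : ℂ :=
  (Matrix.of (F.piecewise K (1 - K : Matrix α α ℂ))).det

theorem sum_dppWeight (K : Matrix α α ℂ) (A : Finset α) :
    ∑ F ∈ univ.filter (fun F => A ⊆ F), dppWeight K F = (principalSub K A).det := by
  rw [det_principalSub]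
  have hadd : A.piecewise K (1 : Matrix α α ℂ)
      = (fun i => K i) + A.piecewise (0 : Matrix α α ℂ) (1 - K : Matrix α α ℂ) := by
    ext i j
    by_cases hi : i ∈ A <;> simp [Finset.piecewise, hi]
  have hexpand := (detRowAlternating (R := ℂ) (n := α)).map_add_univ (fun i => K i)
    (A.piecewise (0 : Matrix α α ℂ) (1 - K : Matrix α α ℂ))
  rw [← hadd] at hexpand
  refine Eq.trans ?_ hexpand.symm
  rw [sum_filter]
  refine sum_congr rfl fun F _ => ?_
  split_ifs with hAF
  · refine congrArg det ?_
    ext i j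
    by_cases hi : i ∈ F
    · simp [Finset.piecewise, hi]
    · have hiA : i ∉ A := fun h => hi (hAF h)
      simp [Finset.piecewise, hi, hiA]
  · obtain ⟨i, hiA, hiF⟩ := Finset.not_subset.1 hAF
    refine (det_eq_zero_of_row_eq_zero (R := ℂ) i fun j => ?_).symm
    simp [Finset.piecewise, hiA, hiF]

theorem dppWeight_nonneg_of_posDef {K : Matrix α α ℂ} (hK0 : K.PosSemidef)
    (hK1 : (1 - K).PosDef) (F : Finset α) : 0 ≤ dppWeight K F := by
  set C := 1 - K with hC
  have hunit : IsUnit C.det := (isUnit_iff_isUnit_det C).1 hK1.isUnit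
  have hL : (K * C⁻¹).PosSemidef := by
    have h := (posSemidef_mul_one_sub hK0 hK1.posSemidef).conjTranspose_mul_mul_same C⁻¹
    rw [hK1.isHermitian.inv.eq] at h
    have hcomm : K * C = C * K := by rw [hC]; noncomm_ring
    rw [← hC, hcomm, ← mul_assoc, nonsing_inv_mul _ hunit, one_mul] at h
    exact h
  have hfac : Matrix.of (F.piecewise K C)
      = Matrix.of (F.piecewise (K * C⁻¹) (1 : Matrix α α ℂ)) * C := by
    ext i j
    by_cases hi : i ∈ F
    · have h := congrFun (congrFun (nonsing_inv_mul_cancel_right (A := C) K hunit) i) j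
      simp only [of_apply, Finset.piecewise, hi, if_true, mul_apply] at h ⊢
      exact h.symm
    · have h := congrFun (congrFun (one_mul C) i) j
      simp only [of_apply, Finset.piecewise, hi, if_false, mul_apply] at h ⊢
      exact h.symm
  rw [dppWeight, ← hC, hfac, det_mul, ← det_principalSub]
  exact mul_nonneg (hL.submatrix _).det_nonneg hK1.posSemidef.det_nonneg

theorem dppWeight_nonneg {K : Matrix α α ℂ} (hK0 : K.PosSemidef)
    (hK1 : (1 - K).PosSemidef) (F : Finset α) : 0 ≤ dppWeight K F := by
  have hcont : Continuous fun t : ℝ => dppWeight (t • K) F := by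
    refine Continuous.matrix_det (continuous_pi fun i => continuous_pi fun j => ?_)
    by_cases hi : i ∈ F
    · simp only [of_apply, Finset.piecewise, hi, if_true, Matrix.smul_apply]
      fun_prop
    · simp only [of_apply, Finset.piecewise, hi, if_false, Matrix.smul_apply, Matrix.sub_apply]
      fun_prop
  have hlim := (hcont.tendsto 1).mono_left (nhdsWithin_le_nhds (s := Set.Iio (1 : ℝ)))
  rw [one_smul] at hlim
  refine ge_of_tendsto hlim ?_
  filter_upwards [Ioo_mem_nhdsLT (zero_lt_one' ℝ)] with t ht
  refine dppWeight_nonneg_of_posDef (hK0.smul ht.1.le) ?_ F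
  have hsplit : 1 - t • K = (1 - t) • (1 : Matrix α α ℂ) + t • (1 - K) := by
    rw [smul_sub, sub_smul, one_smul]; abel
  rw [hsplit]
  exact (PosDef.one.smul (sub_pos.2 ht.2)).add_posSemidef (hK1.smul ht.1.le)

theorem exists_isDPP {K : Matrix α α ℂ} (hK0 : K.PosSemidef) (hK1 : (1 - K).PosSemidef) :
    ∃ ν : Finset α → ℝ, (∀ F, 0 ≤ ν F) ∧ IsDPP ν K := by
  refine ⟨fun F => (dppWeight K F).re, fun F => (Complex.le_def.1 (dppWeight_nonneg hK0 hK1 F)).1,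
    fun A => ?_⟩
  rw [← sum_dppWeight, Complex.ofReal_sum]
  refine sum_congr rfl fun F _ => ?_
  exact (Complex.eq_re_of_ofReal_le (r := 0) (by simpa using dppWeight_nonneg hK0 hK1 F)).symm

/-- Every kernel is a corner of a projection kernel. -/
theorem exists_projection_dilation {K : Matrix α α ℂ} (hK0 : K.PosSemidef)
    (hK1 : (1 - K).PosSemidef) :
    ∃ B : Matrix α α ℂ, (fromBlocks K B B (1 - K)).IsHermitian ∧
      fromBlocks K B B (1 - K) * fromBlocks K B B (1 - K) = fromBlocks K B B (1 - K) := by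
  have hsa : IsSelfAdjoint K := hK0.isHermitian
  set B : Matrix α α ℂ := cfc (fun x : ℝ => √(x * (1 - x))) K with hB
  have hBh : B.IsHermitian := (cfc_predicate (R := ℝ) _ K : IsSelfAdjoint _)
  have hBB : B * B = K * (1 - K) := by
    have h1 : cfc (fun x : ℝ => x * (1 - x)) K = K * (1 - K) := by
      rw [cfc_mul .., cfc_sub .., cfc_const_one .., cfc_id' ..]
    rw [hB, ← cfc_mul .., ← h1]
    refine cfc_congr fun x hx => Real.mul_self_sqrt (mul_nonneg ?_ (sub_nonneg.2 ?_))
    · exact spectrum_nonneg_of_nonneg (nonneg_iff_posSemidef.2 hK0) hx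
    · exact (le_algebraMap_iff_spectrum_le (a := K) (r := (1 : ℝ))).1
        (by simpa using le_iff.2 hK1) x hx
  have hcomm : B * K = K * B := by
    have h := cfc_commute_cfc (fun x : ℝ => √(x * (1 - x))) (fun x => x) K
    rw [cfc_id' ..] at h
    exact h
  refine ⟨B, hK0.isHermitian.fromBlocks hBh.eq hK1.isHermitian, ?_⟩
  rw [fromBlocks_multiply, hBB]
  congr 1
  · noncomm_ring
  · rw [mul_sub, hcomm]; noncomm_ring
  · rw [hcomm]; noncomm_ring
  · noncomm_ring

theorem posSemidef_of_projection {α : Type*} [Fintype α] {P : Matrix α α ℂ}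
    (hP : P.IsHermitian) (hPP : P * P = P) :
    P.PosSemidef := by
  have h := posSemidef_conjTranspose_mul_self P
  rwa [hP.eq, hPP] at h

/-- Every determinantal point process is the trace on a subset of a determinantal point process
with projection kernel. -/
theorem IsDPP.exists_projection {K : Matrix α α ℂ} (hK0 : K.PosSemidef)
    (hK1 : (1 - K).PosSemidef) {μ : Finset α → ℝ} (h : IsDPP μ K) :
    ∃ (P : Matrix (α ⊕ α) (α ⊕ α) ℂ) (ν : Finset (α ⊕ α) → ℝ), P.IsHermitian ∧ P * P = P ∧
      P.trace = (Fintype.card α : ℕ) ∧ (∀ i, P (.inl i) (.inl i) = K i i) ∧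
      (∀ G, 0 ≤ ν G) ∧ IsDPP ν P ∧
      ∀ f : Finset α → ℝ, ∑ F, μ F * f F = ∑ G, ν G * f G.toLeft := by
  obtain ⟨B, hP, hPP⟩ := exists_projection_dilation hK0 hK1
  set P := fromBlocks K B B (1 - K) with hPdef
  have hP1 : (1 - P).PosSemidef := by
    refine posSemidef_of_projection (isHermitian_one.sub hP) ?_
    rw [mul_sub, sub_mul, sub_mul, hPP]
    simp
  obtain ⟨ν, hν0, hν⟩ := exists_isDPP (posSemidef_of_projection hP hPP) hP1
  refine ⟨P, ν, hP, hPP, ?_, fun i => rfl, hν0, hν, fun f => ?_⟩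
  · simp [hPdef, trace, Fintype.sum_sum_type]
  have hmarg : IsDPP (fun F => ∑ G ∈ univ.filter (fun G : Finset (α ⊕ α) => G.toLeft = F), ν G)
      K := by
    intro A
    have hdet : (principalSub P (A.map .inl)).det = (principalSub K A).det := by
      let e : A ≃ (A.map (Function.Embedding.inl : α ↪ α ⊕ α)) := A.equivMap _
      rw [← det_submatrix_equiv_self e]
      rfl
    rw [← hdet, ← hν (A.map .inl)]
    congr 1
    have hsub : ∀ G : Finset (α ⊕ α), A.map .inl ⊆ G ↔ A ⊆ G.toLeft := fun G => by
      simp [Finset.subset_iff]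
    rw [← sum_fiberwise_of_maps_to (s := univ.filter (fun G : Finset (α ⊕ α) => A.map .inl ⊆ G))
      (t := univ.filter (fun F => A ⊆ F)) (g := fun G => G.toLeft)
      (fun G hG => by simpa [hsub] using hG)]
    refine sum_congr rfl fun F hF => sum_congr ?_ fun _ _ => rfl
    ext G
    have hF' := (mem_filter.1 hF).2
    simp only [mem_filter, mem_univ, true_and, hsub]
    constructor
    · rintro rfl; exact ⟨hF', rfl⟩
    · exact fun hG => hG.2
  rw [h.unique hmarg, ← sum_fiberwise (g := fun G : Finset (α ⊕ α) => G.toLeft)]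
  refine sum_congr rfl fun F _ => ?_
  rw [sum_mul]
  exact sum_congr rfl fun G hG => by rw [(mem_filter.1 hG).2]

end Existence

section TraceMomentGeneratingFunction

open scoped MatrixOrder Matrix.Norms.L2Operator

variable {α : Type*} [Fintype α] [DecidableEq α] {ι : Type*} [Fintype ι] [DecidableEq ι]

theorem smul_le_abs_mul_smul_one {A : Matrix ι ι ℂ} {r : ℝ} (h0 : 0 ≤ A) (h1 : A ≤ r • 1)
    (t : ℝ) : t • A ≤ (|t| * r) • (1 : Matrix ι ι ℂ) :=
  calc t • A ≤ |t| • A := smul_le_smul_of_nonneg_right (le_abs_self t) h0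
    _ ≤ |t| • (r • (1 : Matrix ι ι ℂ)) := smul_le_smul_of_nonneg_left h1 (abs_nonneg t)
    _ = _ := smul_smul ..

theorem exp_smul_sub_smul_le {A B : Matrix ι ι ℂ} {r s t : ℝ} (hr : 0 < r) (hA0 : 0 ≤ A)
    (hA1 : A ≤ r • 1) (hB0 : 0 ≤ B) (hB1 : B ≤ r • 1) (hst : (|s| + |t|) * r ≤ 1) :
    NormedSpace.exp (s • A - t • B)
      ≤ 1 + (s + 2 * r * s ^ 2) • A + (2 * r * t ^ 2 - t) • B := by
  have hsA := isHermitian_realSmul (nonneg_iff_posSemidef.1 hA0).isHermitian s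
  have htB := isHermitian_realSmul (nonneg_iff_posSemidef.1 hB0).isHermitian t
  have hone : ((|s| + |t|) * r) • (1 : Matrix ι ι ℂ) ≤ 1 := by
    have h := smul_le_smul_of_nonneg_right hst (zero_le_one (α := Matrix ι ι ℂ))
    rwa [one_smul] at h
  have hsum : (|s| * r) • (1 : Matrix ι ι ℂ) + (|t| * r) • 1 ≤ 1 := by
    rwa [← add_smul, ← add_mul]
  have hupper : s • A - t • B ≤ 1 := by
    have h1 := smul_le_abs_mul_smul_one hA0 hA1 s
    have h2 := smul_le_abs_mul_smul_one hB0 hB1 (-t)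
    rw [abs_neg, neg_smul] at h2
    rw [sub_eq_add_neg]
    exact (add_le_add h1 h2).trans hsum
  have hlower : -1 ≤ s • A - t • B := by
    have h1 := smul_le_abs_mul_smul_one hA0 hA1 (-s)
    have h2 := smul_le_abs_mul_smul_one hB0 hB1 t
    rw [abs_neg, neg_smul] at h1
    rw [neg_le, neg_sub, sub_eq_neg_add]
    exact (add_le_add h1 h2).trans hsum
  have hA2 : (s • A) * (s • A) ≤ (r * s ^ 2) • A := by
    have h := smul_le_smul_of_nonneg_left (mul_self_le_smul hr hA0 hA1) (sq_nonneg s)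
    rw [smul_smul, mul_comm (s ^ 2)] at h
    rwa [smul_mul_smul_comm, ← sq]
  have hB2 : (t • B) * (t • B) ≤ (r * t ^ 2) • B := by
    have h := smul_le_smul_of_nonneg_left (mul_self_le_smul hr hB0 hB1) (sq_nonneg t)
    rw [smul_smul, mul_comm (t ^ 2)] at h
    rwa [smul_mul_smul_comm, ← sq]
  calc NormedSpace.exp (s • A - t • B)
      ≤ 1 + (s • A - t • B) + (s • A - t • B) * (s • A - t • B) :=
        exp_le_one_add_add_sq (hsA.sub htB) hlower hupper
    _ ≤ 1 + (s • A - t • B) + ((2 : ℝ) • ((r * s ^ 2) • A) + (2 : ℝ) • ((r * t ^ 2) • B)) := by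
        refine add_le_add_right ((sub_mul_self_le hsA htB).trans (add_le_add ?_ ?_)) _
        · exact smul_le_smul_of_nonneg_left hA2 zero_le_two
        · exact smul_le_smul_of_nonneg_left hB2 zero_le_two
    _ = _ := by module

/-- The expectation of `∑ i ∈ X, Y i` for a point process `X` with correlation kernel `P`. -/
noncomputable def intensity (P : Matrix α α ℂ) (Y : α → Matrix ι ι ℂ) : Matrix ι ι ℂ :=
  ∑ i, (P i i).re • Y i

/-- The change of `intensity P Y` under conditioning to contain `x`. -/
noncomputable def intensityDrop (P : Matrix α α ℂ) (Y : α → Matrix ι ι ℂ) (x : α) :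
    Matrix ι ι ℂ :=
  ∑ j, (Complex.normSq (P x j) / (P x x).re) • Y j

theorem sum_normSq_row {α : Type*} [Fintype α] {P : Matrix α α ℂ}
    (hP : P.IsHermitian) (hPP : P * P = P) (x : α) :
    ∑ j, Complex.normSq (P x j) = (P x x).re := by
  have h := congrArg Complex.re (congrFun (congrFun hPP x) x)
  rw [mul_apply, Complex.re_sum] at h
  rw [← h]
  refine sum_congr rfl fun j _ => ?_
  rw [← hP.apply j x, ← starRingEnd_apply, Complex.mul_conj, Complex.ofReal_re]

theorem intensity_condKernel {P : Matrix α α ℂ} (hP : P.IsHermitian) {x : α}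
    (hx : P x x = ((P x x).re : ℂ)) {ι : Type*} (Y : α → Matrix ι ι ℂ) :
    intensity (condKernel P x) Y = intensity P Y - intensityDrop P Y x := by
  unfold intensity intensityDrop
  rw [← sum_sub_distrib]
  refine sum_congr rfl fun j _ => ?_
  have hentry : (P x x)⁻¹ * (P j x * P x j)
      = ((Complex.normSq (P x j) / (P x x).re : ℝ) : ℂ) := by
    rw [← hP.apply j x, ← starRingEnd_apply, ← Complex.normSq_eq_conj_mul_self,
      Complex.ofReal_div, ← hx, div_eq_inv_mul]
  rw [← sub_smul, condKernel_apply, hentry, Complex.sub_re, Complex.ofReal_re]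

theorem intensityDrop_nonneg {α : Type*} [Fintype α] {P : Matrix α α ℂ} {x : α}
    (hx : 0 ≤ (P x x).re)
    {Y : α → Matrix ι ι ℂ} (hY : ∀ i, 0 ≤ Y i) : 0 ≤ intensityDrop P Y x :=
  sum_nonneg fun j _ => smul_nonneg (div_nonneg (Complex.normSq_nonneg _) hx) (hY j)

theorem intensityDrop_le {α : Type*} [Fintype α] {P : Matrix α α ℂ}
    (hP : P.IsHermitian) (hPP : P * P = P) {x : α}
    (hx : 0 < (P x x).re) {Y : α → Matrix ι ι ℂ} {r : ℝ} (hY : ∀ i, Y i ≤ r • 1) :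
    intensityDrop P Y x ≤ r • 1 := by
  calc intensityDrop P Y x
      ≤ ∑ j, (Complex.normSq (P x j) / (P x x).re) • (r • (1 : Matrix ι ι ℂ)) :=
        sum_le_sum fun j _ => smul_le_smul_of_nonneg_left (hY j)
          (div_nonneg (Complex.normSq_nonneg _) hx.le)
    _ = r • 1 := by
        rw [← sum_smul, ← sum_div, sum_normSq_row hP hPP, div_self hx.ne', one_smul]

theorem sum_smul_intensityDrop {α : Type*} [Fintype α] {P : Matrix α α ℂ}
    (hP : P.IsHermitian) (hPP : P * P = P)
    {ι : Type*} (Y : α → Matrix ι ι ℂ) :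
    ∑ x, (P x x).re • intensityDrop P Y x = intensity P Y := by
  unfold intensity intensityDrop
  simp only [smul_sum, smul_smul]
  rw [sum_comm]
  refine sum_congr rfl fun j _ => ?_
  rw [← sum_smul, ← sum_normSq_row hP hPP j]
  congr 1
  refine sum_congr rfl fun x _ => ?_
  rw [← hP.apply j x, ← starRingEnd_apply, Complex.normSq_conj]
  refine mul_div_cancel_of_imp' fun h0 => ?_
  rw [← sum_normSq_row hP hPP, sum_eq_zero_iff_of_nonneg fun _ _ => Complex.normSq_nonneg _] at h0
  exact h0 j (mem_univ j)

/-- Domination of the trace moment generating function of a projection determinantal point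
process by that of a deterministic matrix. -/
theorem IsDPP.sum_mul_trace_exp_le_of_projection {Y : α → Matrix ι ι ℂ} {r s t : ℝ} (hr : 0 < r)
    (hY0 : ∀ i, 0 ≤ Y i) (hY1 : ∀ i, Y i ≤ r • 1) (hst : (|s| + |t|) * r ≤ 1)
    (hdrift : 2 * r * (s ^ 2 + t ^ 2) ≤ t - s) (n : ℕ) :
    ∀ {P : Matrix α α ℂ} {ν : Finset α → ℝ}, P.IsHermitian → P * P = P → P.trace = n →
      (∀ F, 0 ≤ ν F) → IsDPP ν P → ∀ {H : Matrix ι ι ℂ}, H.IsHermitian →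
      ∑ F, ν F * (NormedSpace.exp (H + s • ∑ i ∈ F, Y i)).trace.re
        ≤ (NormedSpace.exp (H + t • intensity P Y)).trace.re := by
  induction n with
  | zero =>
    intro P ν hP hPP hn hν h H hH
    have hcard : ∀ F, ν F ≠ 0 → F = ∅ := fun F hF =>
      card_eq_zero.1 (h.card_eq hν hPP hn hF)
    have hdiag : ∀ i, (P i i).re = 0 := fun i => by
      rw [← h.sum_mem_re]
      refine sum_eq_zero fun F _ => ?_
      by_cases hF : ν F = 0
      · simp [hF]
      · simp [hcard F hF]
    have hint : intensity P Y = 0 := sum_eq_zero fun i _ => by rw [hdiag, zero_smul]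
    have hsum : ∑ F, ν F * (NormedSpace.exp (H + s • ∑ i ∈ F, Y i)).trace.re
        = ∑ F, ν F * (NormedSpace.exp H).trace.re := by
      refine sum_congr rfl fun F _ => ?_
      by_cases hF : ν F = 0
      · simp [hF]
      · simp [hcard F hF]
    rw [hsum, ← sum_mul, h.sum_eq_one, one_mul, hint, smul_zero, add_zero]
  | succ n ih =>
    intro P ν hP hPP hn hν h H hH
    set f : Finset α → ℝ := fun F => (NormedSpace.exp (H + s • ∑ i ∈ F, Y i)).trace.re with hf
    set R := intensity P Y with hR
    set L := NormedSpace.exp (H + t • R) with hL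
    have hp : ∀ x, 0 ≤ (P x x).re := fun x => by
      rw [← h.sum_mem_re]
      exact sum_nonneg fun F _ => by split_ifs; exacts [hν F, le_rfl]
    have hR0 : 0 ≤ R := sum_nonneg fun i _ => smul_nonneg (hp i) (hY0 i)
    have hRh : R.IsHermitian := (nonneg_iff_posSemidef.1 hR0).isHermitian
    have hLpos : L.PosSemidef := posSemidef_exp (hH.add (isHermitian_realSmul hRh t))
    have hpoint : ∀ x, (∑ F, if x ∈ F then ν F * f F else 0) ≤
        (L * ((P x x).re • (1 + (s + 2 * r * s ^ 2) • Y x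
          + (2 * r * t ^ 2 - t) • intensityDrop P Y x))).trace.re := by
      intro x
      rcases (hp x).eq_or_lt with hx0 | hx0
      · rw [← hx0, zero_smul, mul_zero, trace_zero, Complex.zero_re]
        refine (sum_eq_zero fun F _ => ?_).le
        have h0 := h.sum_mem_re x
        rw [← hx0, sum_eq_zero_iff_of_nonneg
          (fun F _ => by split_ifs; exacts [hν F, le_rfl])] at h0
        have := h0 F (mem_univ F)
        split_ifs at this ⊢ with hxF
        · rw [this, zero_mul]
        · rfl
      have hx : P x x ≠ 0 := fun h0 => hx0.ne' (by rw [h0, Complex.zero_re])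
      have hYx := nonneg_iff_posSemidef.1 (hY0 x)
      have hQ0 := intensityDrop_nonneg (hp x) hY0
      have hQ1 := intensityDrop_le hP hPP hx0 hY1
      have hcond := ih (isHermitian_condKernel hP x) (condKernel_mul_self hPP hx)
        (by rw [trace_condKernel hPP hx, hn]; push_cast; ring)
        (fun F => by
          unfold condWeight
          split_ifs
          exacts [le_rfl, div_nonneg (hν _) hx0.le])
        (h.cond hx0.ne') (hH.add (isHermitian_realSmul hYx.isHermitian s))
      have hshift : ∑ F, condWeight ν (P x x).re x F * f (insert x F)
          = ∑ F, condWeight ν (P x x).re x F *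
            (NormedSpace.exp (H + s • Y x + s • ∑ i ∈ F, Y i)).trace.re := by
        refine sum_congr rfl fun F _ => ?_
        by_cases hxF : x ∈ F
        · simp [condWeight, hxF]
        · rw [hf]
          simp only [sum_insert hxF, smul_add, add_assoc]
      rw [← sum_condWeight_mul ν f hx0.ne' x, hshift, mul_smul_comm, trace_smul, Complex.smul_re,
        smul_eq_mul]
      refine mul_le_mul_of_nonneg_left (hcond.trans ?_) (hp x)
      rw [intensity_condKernel hP (h.diag_eq x)]
      have hsplit : H + s • Y x + t • (intensity P Y - intensityDrop P Y x)
          = (H + t • R) + (s • Y x - t • intensityDrop P Y x) := by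
        rw [smul_sub]; abel
      rw [hsplit]
      refine (trace_exp_add_le (hH.add (isHermitian_realSmul hRh t))
        ((isHermitian_realSmul hYx.isHermitian s).sub (isHermitian_realSmul
          (nonneg_iff_posSemidef.1 hQ0).isHermitian t))).trans ?_
      exact trace_mul_re_mono hLpos
        (exp_smul_sub_smul_le hr (hY0 x) (hY1 x) hQ0 hQ1 hst)
    have hcount : ((n : ℝ) + 1) * ∑ F, ν F * f F
        = ∑ x, ∑ F, if x ∈ F then ν F * f F else 0 := by
      rw [sum_comm, mul_sum]
      refine sum_congr rfl fun F _ => ?_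
      rw [← sum_filter, sum_const, nsmul_eq_mul, filter_mem_eq_inter, univ_inter]
      by_cases hF : ν F = 0
      · simp [hF]
      · rw [h.card_eq hν hPP hn hF]; push_cast; ring
    have htr : ∑ x, (P x x).re = (n : ℝ) + 1 := by
      have := congrArg Complex.re hn
      rw [trace, Complex.re_sum] at this
      simpa using this
    have hmean : ∑ x, (P x x).re • (1 + (s + 2 * r * s ^ 2) • Y x
          + (2 * r * t ^ 2 - t) • intensityDrop P Y x)
        = ((n : ℝ) + 1) • 1 + (2 * r * (s ^ 2 + t ^ 2) - (t - s)) • R := by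
      have h1 : ∑ x, (P x x).re • (1 + (s + 2 * r * s ^ 2) • Y x
          + (2 * r * t ^ 2 - t) • intensityDrop P Y x)
          = (∑ x, (P x x).re) • 1 + (s + 2 * r * s ^ 2) • (∑ x, (P x x).re • Y x)
            + (2 * r * t ^ 2 - t) • ∑ x, (P x x).re • intensityDrop P Y x := by
        rw [sum_smul, smul_sum, smul_sum, ← sum_add_distrib, ← sum_add_distrib]
        refine sum_congr rfl fun x _ => ?_
        module
      rw [h1, htr, sum_smul_intensityDrop hP hPP, ← intensity, ← hR]
      module
    have hle : ((n : ℝ) + 1) • 1 + (2 * r * (s ^ 2 + t ^ 2) - (t - s)) • R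
        ≤ ((n : ℝ) + 1) • (1 : Matrix ι ι ℂ) := by
      have := smul_nonneg (sub_nonneg.2 hdrift) hR0
      rw [← neg_sub, neg_smul, ← sub_eq_add_neg]
      exact sub_le_self _ this
    have hfinal : ((n : ℝ) + 1) * ∑ F, ν F * f F ≤ ((n : ℝ) + 1) * L.trace.re := by
      calc ((n : ℝ) + 1) * ∑ F, ν F * f F
          ≤ ∑ x, (L * ((P x x).re • (1 + (s + 2 * r * s ^ 2) • Y x
            + (2 * r * t ^ 2 - t) • intensityDrop P Y x))).trace.re := by
            rw [hcount]; exact sum_le_sum fun x _ => hpoint x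
        _ = (L * (((n : ℝ) + 1) • 1
              + (2 * r * (s ^ 2 + t ^ 2) - (t - s)) • R)).trace.re := by
            rw [← hmean, mul_sum, trace_sum, Complex.re_sum]
        _ ≤ (L * (((n : ℝ) + 1) • 1)).trace.re := trace_mul_re_mono hLpos hle
        _ = _ := by
            rw [mul_smul_comm, mul_one, trace_smul, Complex.smul_re, smul_eq_mul]
    exact le_of_mul_le_mul_left hfinal (by positivity)

theorem IsDPP.sum_mul_trace_exp_le {K : Matrix α α ℂ} (hK0 : K.PosSemidef)
    (hK1 : (1 - K).PosSemidef) {μ : Finset α → ℝ} (h : IsDPP μ K) {Y : α → Matrix ι ι ℂ}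
    {r s t : ℝ} (hr : 0 < r) (hY0 : ∀ i, 0 ≤ Y i) (hY1 : ∀ i, Y i ≤ r • 1)
    (hst : (|s| + |t|) * r ≤ 1) (hdrift : 2 * r * (s ^ 2 + t ^ 2) ≤ t - s)
    {H : Matrix ι ι ℂ} (hH : H.IsHermitian) :
    ∑ F, μ F * (NormedSpace.exp (H + s • ∑ i ∈ F, Y i)).trace.re
      ≤ (NormedSpace.exp (H + t • intensity K Y)).trace.re := by
  obtain ⟨P, ν, hP, hPP, hn, hPK, hν, hνP, hpush⟩ := h.exists_projection hK0 hK1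
  have hZ0 : ∀ i, 0 ≤ Sum.elim Y (fun _ : α => 0) i := by
    rintro (i | i)
    exacts [hY0 i, le_rfl]
  have hZ1 : ∀ i, Sum.elim Y (fun _ : α => 0) i ≤ r • 1 := by
    rintro (i | i)
    exacts [hY1 i, smul_nonneg hr.le zero_le_one]
  have hmain := IsDPP.sum_mul_trace_exp_le_of_projection hr hZ0 hZ1 hst hdrift _ hP hPP hn hν hνP hH
  have hint : intensity P (Sum.elim Y fun _ => 0) = intensity K Y := by
    simp [intensity, Fintype.sum_sum_type, hPK]
  rw [hint] at hmain
  rw [hpush fun F => (NormedSpace.exp (H + s • ∑ i ∈ F, Y i)).trace.re]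
  convert! hmain using 5 with G
  rw [← Finset.toLeft_disjSum_toRight (u := G)]
  simp [sum_disjSum]

theorem IsDPP.sum_smul_sum {μ : Finset α → ℝ} {K : Matrix α α ℂ} (h : IsDPP μ K) {ι : Type*}
    (Y : α → Matrix ι ι ℂ) : ∑ F, μ F • ∑ i ∈ F, Y i = intensity K Y := by
  simp only [intensity, ← h.sum_mem_re, sum_smul]
  rw [sum_comm]
  refine sum_congr rfl fun F _ => ?_
  simp only [ite_smul, zero_smul]
  rw [← sum_filter, filter_mem_eq_inter, univ_inter, smul_sum]

theorem trace_exp_add_trace_exp_neg_sub_nonneg {A : Matrix ι ι ℂ} (hA : A.IsHermitian)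
    (s : ℝ) :
    0 ≤ (NormedSpace.exp (s • A)).trace.re + (NormedSpace.exp ((-s) • A)).trace.re
      - 2 * Fintype.card ι := by
  rw [trace_exp_smul_re hA, trace_exp_smul_re hA, ← sum_add_distrib, sub_nonneg]
  have hcard : (2 * Fintype.card ι : ℝ) = ∑ _i : ι, (2 : ℝ) := by simp [mul_comm]
  rw [hcard]
  refine sum_le_sum fun i _ => ?_
  have h1 := Real.one_le_cosh (s * hA.eigenvalues i)
  rw [Real.cosh_eq] at h1
  rw [neg_mul]
  linarith

theorem trace_exp_smul_le {A M : Matrix ι ι ℂ} (hA : 0 ≤ A) (hAM : A ≤ M) (hM : M ≠ 0) {b : ℝ}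
    (hb : 0 < b) :
    (NormedSpace.exp (b • A)).trace.re
      ≤ Fintype.card ι + M.trace.re / ‖M‖ * Real.exp (b * ‖M‖) := by
  have hMpos : 0 < ‖M‖ := norm_pos_iff.2 hM
  have hM0 : 0 ≤ M := hA.trans hAM
  have hMle : b • A ≤ algebraMap ℝ _ (b * ‖M‖) := by
    have h1 : A ≤ algebraMap ℝ _ ‖M‖ :=
      hAM.trans (IsSelfAdjoint.le_algebraMap_norm_self (.of_nonneg hM0))
    have h2 := smul_le_smul_of_nonneg_left h1 hb.le
    rwa [Algebra.algebraMap_eq_smul_one, smul_smul, ← Algebra.algebraMap_eq_smul_one] at h2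
  have hexp := trace_re_mono (exp_le_one_add_smul (smul_nonneg hb.le hA) (mul_pos hb hMpos) hMle)
  have htr := trace_re_mono hAM
  have htr0 := trace_re_mono hM0
  rw [trace_zero, Complex.zero_re] at htr0
  rw [trace_add, trace_one, smul_smul, trace_smul, Complex.add_re, Complex.smul_re,
    Complex.natCast_re, smul_eq_mul] at hexp
  refine hexp.trans (add_le_add_right ?_ _)
  have hcoef : (Real.exp (b * ‖M‖) - 1) / (b * ‖M‖) * b = (Real.exp (b * ‖M‖) - 1) / ‖M‖ := by
    field_simp
  have hge : 0 ≤ Real.exp (b * ‖M‖) - 1 := sub_nonneg.2 (Real.one_le_exp (by positivity))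
  rw [hcoef]
  calc (Real.exp (b * ‖M‖) - 1) / ‖M‖ * A.trace.re
      ≤ (Real.exp (b * ‖M‖) - 1) / ‖M‖ * M.trace.re := by gcongr
    _ ≤ Real.exp (b * ‖M‖) / ‖M‖ * M.trace.re := by gcongr; linarith
    _ = _ := by ring

theorem exp_le_one_add_three_div_sq_mul {x : ℝ} (hx : 0 < x) :
    Real.exp x ≤ (1 + 3 / x ^ 2) * (Real.exp x - x - 1) := by
  have h := Real.sum_le_exp_of_nonneg hx.le 5
  simp only [sum_range_succ, sum_range_zero, Nat.factorial] at h
  norm_num at h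
  have hpoly : (x ^ 2 + 3) * (x + 1) ≤ 3 * Real.exp x := by
    nlinarith [sq_nonneg (x * (1 - x / 2))]
  have hdiff : (1 + 3 / x ^ 2) * (Real.exp x - x - 1) - Real.exp x
      = (3 * Real.exp x - (x ^ 2 + 3) * (x + 1)) / x ^ 2 := by
    field_simp
    ring
  have := div_nonneg (sub_nonneg.2 hpoly) (sq_nonneg x)
  linarith

theorem IsDPP.sum_norm_sub_intensity_ge_le {K : Matrix α α ℂ} (hK0 : K.PosSemidef)
    (hK1 : (1 - K).PosSemidef) {μ : Finset α → ℝ} (hμ : ∀ F, 0 ≤ μ F) (h : IsDPP μ K)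
    {Y : α → Matrix ι ι ℂ} {r : ℝ} (hr : 0 < r) (hY0 : ∀ i, 0 ≤ Y i) (hY1 : ∀ i, Y i ≤ r • 1)
    {M : Matrix ι ι ℂ} (hM : M ≠ 0) (hYM : intensity K Y ≤ M) {ε : ℝ} (hε0 : 0 < ε)
    (hε1 : ε ≤ 1) :
    (∑ F, if ε * ‖M‖ ≤ ‖(∑ i ∈ F, Y i) - intensity K Y‖ then μ F else 0)
      ≤ 2 * (M.trace.re / ‖M‖) * (1 + (3 * 37 ^ 2) * r ^ 2 / (‖M‖ ^ 2 * ε ^ 4)) *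
        Real.exp (-((1 / (2 * 37)) * (‖M‖ * ε ^ 2 / r))) := by
  set E := intensity K Y with hE
  have hMpos : 0 < ‖M‖ := norm_pos_iff.2 hM
  have hE0 : 0 ≤ E := sum_nonneg fun i _ => smul_nonneg
    (by rw [← h.sum_mem_re]; exact sum_nonneg fun F _ => by split_ifs; exacts [hμ F, le_rfl])
    (hY0 i)
  have hEh : E.IsHermitian := (nonneg_iff_posSemidef.1 hE0).isHermitian
  have hZh : ∀ F : Finset α, ((∑ i ∈ F, Y i) - E).IsHermitian := fun F =>
    (nonneg_iff_posSemidef.1 (sum_nonneg fun i _ => hY0 i)).isHermitian.sub hEh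
  set s := ε / (37 * r) with hs
  set b := ε ^ 2 / (74 * r) with hb
  have hs0 : 0 < s := by positivity
  have hb0 : 0 < b := by positivity
  have hsr : s * r = ε / 37 := by rw [hs]; field_simp
  have hbs : b ≤ s / 2 := by
    rw [hs, hb, div_div, div_le_div_iff₀ (by positivity) (by positivity)]
    nlinarith [mul_pos hε0 hr]
  have hbr : b = 37 / 2 * r * s ^ 2 := by rw [hs, hb]; field_simp; ring
  have hmgf : ∀ σ : ℝ, |σ| = s →
      ∑ F, μ F * (NormedSpace.exp (σ • ((∑ i ∈ F, Y i) - E))).trace.re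
        ≤ (NormedSpace.exp (b • E)).trace.re := by
    intro σ hσ
    have hσ2 : σ ^ 2 = s ^ 2 := by rw [← hσ, sq_abs]
    have habs : |σ + b| ≤ s + b := by
      have := abs_add_le σ b
      rwa [hσ, abs_of_pos hb0] at this
    have hsq : (σ + b) ^ 2 ≤ (s + b) ^ 2 := sq_le_sq' (by linarith [(abs_le.1 habs).1])
      (abs_le.1 habs).2
    have hst : (|σ| + |σ + b|) * r ≤ 1 := by
      rw [hσ]
      nlinarith
    have hdrift : 2 * r * (σ ^ 2 + (σ + b) ^ 2) ≤ σ + b - σ := by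
      have h1 : (s + b) ^ 2 ≤ (3 / 2 * s) ^ 2 := pow_le_pow_left₀ (by positivity) (by linarith) 2
      have h2 : σ ^ 2 + (σ + b) ^ 2 ≤ 13 / 4 * s ^ 2 := by linarith
      have h3 := mul_le_mul_of_nonneg_left h2 (by positivity : 0 ≤ 2 * r)
      have h4 : 0 ≤ r * s ^ 2 := by positivity
      linarith
    have key := h.sum_mul_trace_exp_le hK0 hK1 hr hY0 hY1 hst hdrift
      (isHermitian_realSmul hEh (-σ))
    have hleft : ∀ F : Finset α, -σ • E + σ • ∑ i ∈ F, Y i = σ • ((∑ i ∈ F, Y i) - E) :=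
      fun F => by module
    have hright : -σ • E + (σ + b) • E = b • E := by module
    simpa only [← hE, hleft, hright] using key
  set x := s * (ε * ‖M‖) with hx
  have hx0 : 0 < x := by positivity
  have hbx : b * ‖M‖ = x / 2 := by rw [hx, hs, hb]; field_simp; norm_num
  set ψ := Real.exp x - x - 1 with hψ
  have hψ0 : 0 < ψ := by
    have := Real.add_one_lt_exp hx0.ne'
    rw [hψ]; linarith
  set T := M.trace.re / ‖M‖ with hT
  have hT0 : 0 ≤ T := by
    have := trace_re_mono (hE0.trans hYM)
    rw [trace_zero, Complex.zero_re] at this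
    positivity
  have hmarkov : (∑ F, if ε * ‖M‖ ≤ ‖(∑ i ∈ F, Y i) - E‖ then μ F else 0) * ψ
      ≤ 2 * T * Real.exp (x / 2) := by
    have hpoint : ∀ F, (if ε * ‖M‖ ≤ ‖(∑ i ∈ F, Y i) - E‖ then μ F else 0) * ψ
        ≤ μ F * (NormedSpace.exp (s • ((∑ i ∈ F, Y i) - E))).trace.re
          + μ F * (NormedSpace.exp ((-s) • ((∑ i ∈ F, Y i) - E))).trace.re
          - μ F * (2 * Fintype.card ι) := fun F => by
      rw [← mul_add, ← mul_sub]
      split_ifs with hF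
      · exact mul_le_mul_of_nonneg_left
          (exp_sub_le_trace_exp_add_trace_exp_neg (hZh F) (by positivity) hF) (hμ F)
      · rw [zero_mul]
        exact mul_nonneg (hμ F) (trace_exp_add_trace_exp_neg_sub_nonneg (hZh F) s)
    rw [sum_mul]
    refine (sum_le_sum fun F _ => hpoint F).trans ?_
    rw [sum_sub_distrib, sum_add_distrib, ← sum_mul, h.sum_eq_one, one_mul]
    have h1 := hmgf s (abs_of_pos hs0)
    have h2 := hmgf (-s) (by rw [abs_neg, abs_of_pos hs0])
    have h3 := trace_exp_smul_le hE0 hYM hM hb0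
    rw [hbx] at h3
    linarith
  have hexp := exp_le_one_add_three_div_sq_mul hx0
  have hconst : (3 * 37 ^ 2) * r ^ 2 / (‖M‖ ^ 2 * ε ^ 4) = 3 / x ^ 2 := by
    rw [hx, hs]; field_simp
  have hrate : (1 / (2 * 37)) * (‖M‖ * ε ^ 2 / r) = x / 2 := by
    rw [hx, hs]; field_simp
  rw [hconst, hrate]
  refine le_of_mul_le_mul_right (hmarkov.trans ?_) hψ0
  have hhalf : Real.exp (x / 2) = Real.exp (-(x / 2)) * Real.exp x := by
    rw [← Real.exp_add]; congr 1; ring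
  calc 2 * T * Real.exp (x / 2) = 2 * T * Real.exp (-(x / 2)) * Real.exp x := by
        rw [hhalf]; ring
    _ ≤ 2 * T * Real.exp (-(x / 2)) * ((1 + 3 / x ^ 2) * ψ) := by gcongr
    _ = _ := by ring

end TraceMomentGeneratingFunction

/-- **Matrix Chernoff bound with intrinsic dimension for DPPs.** -/
theorem matrix_chernoff_intrinsic_dpp
    {m d : ℕ} (K : Matrix (Fin m) (Fin m) ℂ) (hKh : K.IsHermitian)
    (hK0 : K.PosSemidef) (hK1 : ((1 : Matrix (Fin m) (Fin m) ℂ) - K).PosSemidef)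
    (μ : Finset (Fin m) → ℝ) (hμ0 : ∀ F, 0 ≤ μ F) (hμ1 : ∑ F, μ F = 1)
    (hdpp : IsDPP μ K)
    (Y : Fin m → Matrix (Fin d) (Fin d) ℂ) (r : ℝ) (hr : 0 < r)
    (hY0 : ∀ i, (Y i).PosSemidef)
    (hYr : ∀ i, ((r : ℂ) • (1 : Matrix (Fin d) (Fin d) ℂ) - Y i).PosSemidef)
    (ES : Matrix (Fin d) (Fin d) ℂ) (hES : ES = ∑ F : Finset (Fin m), μ F • ∑ i ∈ F, Y i)
    (M : Matrix (Fin d) (Fin d) ℂ) (hMh : M.IsHermitian) (hM : M.PosSemidef) (hM0 : M ≠ 0)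
    (hEM : (M - ES).PosSemidef)
    (ε : ℝ) (hε : ε ∈ Set.Ioc (0 : ℝ) 1) :
    (∑ F : Finset (Fin m),
        if ε * opNorm M ≤ opNorm ((∑ i ∈ F, Y i) - ES) then μ F else 0)
      ≤ 2 * (M.trace.re / opNorm M) *
          (1 + (3 * 37 ^ 2) * r ^ 2 / ((opNorm M) ^ 2 * ε ^ 4)) *
          Real.exp (-((1 / (2 * 37)) * (opNorm M * ε ^ 2 / r))) := by
  have hr1 : (r : ℂ) • (1 : Matrix (Fin d) (Fin d) ℂ) = r • 1 := by
    ext i j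
    simp
  have hE : ES = intensity K Y := hES.trans (hdpp.sum_smul_sum Y)
  rw [hE] at hEM ⊢
  exact hdpp.sum_norm_sub_intensity_ge_le hK0 hK1 hμ0 hr
    (fun i => nonneg_iff_posSemidef.2 (hY0 i)) (fun i => le_iff.2 (hr1 ▸ hYr i)) hM0
    (le_iff.2 hEM) hε.1 hε.2
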